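/- arXiv:1603.08143 — 2 statements merged into one kernel-verified Lean document; each statement's English description precedes it below -/
import Mathlib

section
/- Let d ≥ 1 and let R be a subset of the Euclidean space ℝ^d. If there exists a point x ∈ R with ‖x‖ ≤ 3/2, then the Lebesgue measure of B(0,1) ∩ ⋃_{x∈R} B(x,1) is at least 4^{-d} · ν₁, where ν₁ is the Lebesgue measure of the unit ball in ℝ^d. -/
open MeasureTheory

/-- The closed ball of radius `1/4` around the midpoint of `0` and `x` lies in both unit balls
centered at `0` and `x` when `‖x‖ ≤ 3/2`. -/
lemma closedBall_half_smul_subset_inter {E : Type*} [NormedAddCommGroup E] [NormedSpace ℝ E]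
    {x : E} (hx : ‖x‖ ≤ 3 / 2) :
    Metric.closedBall ((1 / 2 : ℝ) • x) (1 / 4) ⊆
      Metric.closedBall 0 1 ∩ Metric.closedBall x 1 := by
  have norm_half : ‖(1 / 2 : ℝ) • x‖ ≤ 3 / 4 := by
    rw [norm_smul, Real.norm_of_nonneg (by norm_num)]
    linarith
  refine Set.subset_inter (Metric.closedBall_subset_closedBall' ?_)
    (Metric.closedBall_subset_closedBall' ?_)
  · rw [dist_zero_right]
    linarith
  · have half_sub : (1 / 2 : ℝ) • x - x = -((1 / 2 : ℝ) • x) := by module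
    rw [dist_eq_norm, half_sub, norm_neg]
    linarith

/-- If `R ⊆ ℝ^d` contains a point `x` with `‖x‖ ≤ 3/2`, then the Lebesgue measure of
`B(0,1) ∩ ⋃_{x ∈ R} B(x,1)` is at least `4^{-d} ν₁`, where `ν₁` is the Lebesgue measure
of the unit ball. -/
theorem volume_inter_union_closedBalls_ge
    (d : ℕ) (hd : 1 ≤ d) (R : Set (EuclideanSpace ℝ (Fin d)))
    (hR : ∃ x ∈ R, ‖x‖ ≤ 3 / 2) :
    volume (Metric.closedBall (0 : EuclideanSpace ℝ (Fin d)) 1) / 4 ^ d ≤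
      volume (Metric.closedBall (0 : EuclideanSpace ℝ (Fin d)) 1 ∩
        ⋃ x ∈ R, Metric.closedBall x 1) := by
  obtain ⟨x, hxR, hx⟩ := hR
  calc volume (Metric.closedBall (0 : EuclideanSpace ℝ (Fin d)) 1) / 4 ^ d
      = volume (Metric.closedBall ((1 / 2 : ℝ) • x) (1 / 4)) := by
        rw [Measure.addHaar_closedBall' volume ((1 / 2 : ℝ) • x) (by norm_num),
          finrank_euclideanSpace_fin,
          one_div, inv_pow, ENNReal.ofReal_inv_of_pos (by positivity),
          ENNReal.ofReal_pow (by norm_num), ENNReal.ofReal_ofNat, div_eq_mul_inv, mul_comm]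
    _ ≤ _ := measure_mono ((closedBall_half_smul_subset_inter hx).trans
        (Set.inter_subset_inter_right _ (Set.subset_biUnion_of_mem
          (u := fun y => Metric.closedBall y 1) hxR)))
end

section
/- Let d ≥ 1, let K ≥ 1 be a natural number, and let R be a subset of the Euclidean space ℝ^d whose points are at pairwise distance strictly greater than 1. Suppose the number of points of R in the closed ball of radius 3/2 centered at the origin is at most K. Then the Lebesgue measure of B(0,1) ∩ ⋃_{x∈R} B(x,1) is at least (ν₁ / (4^d · K)) times the number of points of R in the closed ball of radius 3/2 centered at the origin, where ν₁ is the Lebesgue measure of the unit ball in ℝ^d. -/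
open MeasureTheory

/-- Let `R ⊆ ℝ^d` (`d ≥ 1`) be a set whose points are at pairwise distance strictly greater
than `1`, and suppose the number of points of `R` in the closed ball of radius `3/2` centered
at the origin is at most `K` (`K ≥ 1`). Then the Lebesgue measure of
`B(0,1) ∩ ⋃_{x ∈ R} B(x,1)` is at least `(ν₁ / (4^d K))` times that number of points,
where `ν₁` is the Lebesgue measure of the unit ball. -/
theorem volume_inter_union_closedBalls_ge_card
    (d : ℕ) (hd : 1 ≤ d) (K : ℕ) (hK : 1 ≤ K)
    (R : Set (EuclideanSpace ℝ (Fin d)))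
    (hhard : ∀ x ∈ R, ∀ y ∈ R, x ≠ y → 1 < dist x y)
    (hcard : (R ∩ Metric.closedBall 0 (3 / 2)).ncard ≤ K) :
    volume (Metric.closedBall (0 : EuclideanSpace ℝ (Fin d)) 1) / (4 ^ d * K) *
        (R ∩ Metric.closedBall 0 (3 / 2)).ncard ≤
      volume (Metric.closedBall (0 : EuclideanSpace ℝ (Fin d)) 1 ∩
        ⋃ x ∈ R, Metric.closedBall x 1) := by
  set n := (R ∩ Metric.closedBall 0 (3 / 2)).ncard with hn
  rcases Nat.eq_zero_or_pos n with h0 | hpos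
  · simp [h0]
  obtain ⟨x, hxR, hx⟩ := Set.nonempty_of_ncard_ne_zero (hn ▸ hpos.ne')
  calc
    _ ≤ volume (Metric.closedBall (0 : EuclideanSpace ℝ (Fin d)) 1) / (4 ^ d * K) * K := by
      gcongr
    _ = ENNReal.ofReal ((1 / 4) ^ d) *
        volume (Metric.closedBall (0 : EuclideanSpace ℝ (Fin d)) 1) := by
      have hK0 : (K : ENNReal) ≠ 0 := by exact_mod_cast (show K ≠ 0 by omega)
      rw [div_eq_mul_inv, ENNReal.mul_inv (by simp) (by simp), mul_assoc, mul_assoc,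
        ENNReal.inv_mul_cancel hK0 (ENNReal.natCast_ne_top K), mul_one, mul_comm,
        one_div, inv_pow, ENNReal.ofReal_inv_of_pos (by positivity),
        ENNReal.ofReal_pow (by norm_num)]
      norm_num
    _ = volume (Metric.closedBall ((1 / 2 : ℝ) • x) (1 / 4)) := by
      rw [Measure.addHaar_closedBall' volume ((1 / 2 : ℝ) • x) (by norm_num),
        finrank_euclideanSpace_fin]
    _ ≤ _ := by
      have hx' : ‖x‖ ≤ 3 / 2 := by simpa using hx
      refine measure_mono (Set.subset_inter ?_ ?_)
      · refine Metric.closedBall_subset_closedBall' ?_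
        rw [dist_zero_right, norm_smul]
        norm_num
        linarith
      · refine (Metric.closedBall_subset_closedBall' ?_).trans
          (Set.subset_biUnion_of_mem (u := fun x => Metric.closedBall x 1) hxR)
        have h : (1 / 2 : ℝ) • x - x = (-(1 / 2) : ℝ) • x := by module
        rw [dist_eq_norm, h, norm_smul]
        norm_num
        linarith
end
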